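/- Fix a histogram h : Fin d → ℕ, parameters ε, δ > 0, β ∈ (0,1), a restriction parameter Δ ≥ 1, and integers k ≤ k̄ < d. If h_{(k)} ≥ h_{(k̄+1)} + 1 + ln(min{Δ, k̄}/δ)/ε + ln(k/β)/ε, then with probability at least 1 − β the mechanism prEM_{k,k̄}(h, D_{k̄}(h)) outputs exactly k indices (its output does not contain ⊥). -/

import Mathlib

open scoped BigOperators

/-- The `k`-th largest value among the entries of the histogram `h`. -/
noncomputable def kthLargest {d : ℕ} (h : Fin d → ℕ) (k : ℕ) : ℕ :=
  sSup {v | k ≤ (Finset.univ.filter fun i => v ≤ h i).card}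

/-- Histograms are neighboring if one user's data is added or removed. -/
def Neighbors {d : ℕ} (h h' : Fin d → ℕ) : Prop :=
  (∀ i, h' i ≤ h i ∧ h i ≤ h' i + 1) ∨ (∀ i, h i ≤ h' i ∧ h' i ≤ h i + 1)

/-- `Δ`-restricted-sensitivity neighbors. -/
def RestrictedNeighbors {d : ℕ} (Δ : ℕ) (h h' : Fin d → ℕ) : Prop :=
  Neighbors h h' ∧ (Finset.univ.filter fun i => h i ≠ h' i).card ≤ Δ

/-- The rank of index `i` in the ordering of `h` by decreasing count, ties toward
smaller indices. -/
def histRank {d : ℕ} (h : Fin d → ℕ) (i : Fin d) : ℕ :=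
  (Finset.univ.filter fun j => h i < h j ∨ (h j = h i ∧ j < i)).card

/-- The limited domain `D_k(h)`: the indices of the `k` largest entries of `h`. -/
def limitedDomain {d : ℕ} (h : Fin d → ℕ) (k : ℕ) : Finset (Fin d) :=
  Finset.univ.filter fun i => histRank h i < k

/-- The count `h_⊥ = h_{(k̄+1)} + 1 + ln(min{Δ,k̄}/δ)/ε` assigned to `⊥`. -/
noncomputable def hBot {d : ℕ} (ε δ : ℝ) (Δ kbar : ℕ) (h : Fin d → ℕ) : ℝ :=
  (kthLargest h (kbar + 1) : ℝ) + 1 + Real.log ((min Δ kbar : ℕ) / δ) / ε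

/-- Exponential-mechanism weight of an outcome in `Fin d ∪ {⊥}` (with `⊥ = none`). -/
noncomputable def emWeight {d : ℕ} (ε δ : ℝ) (Δ kbar : ℕ) (h : Fin d → ℕ) :
    Option (Fin d) → ℝ
  | some i => Real.exp (ε * (h i : ℝ))
  | none => Real.exp (ε * hBot ε δ Δ kbar h)

/-- The limited histogram exponential mechanism `ĥEM(h, D)`: probability of outcome `o`
in `D ∪ {⊥}` proportional to its weight. -/
noncomputable def stepProb {d : ℕ} (ε δ : ℝ) (Δ kbar : ℕ) (h : Fin d → ℕ)
    (D : Finset (Fin d)) (o : Option (Fin d)) : ℝ :=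
  emWeight ε δ Δ kbar h o /
    (emWeight ε δ Δ kbar h none + ∑ j ∈ D, emWeight ε δ Δ kbar h (some j))

/-- `prEMProb ε δ Δ kbar h k D l` is the probability that the peeling mechanism
`prEM_{k,k̄}(h, D)` outputs exactly the ordered list `l` (with `⊥ = none`). -/
noncomputable def prEMProb {d : ℕ} (ε δ : ℝ) (Δ kbar : ℕ) (h : Fin d → ℕ) :
    ℕ → Finset (Fin d) → List (Option (Fin d)) → ℝ
  | 0, _, l => if l = [] then 1 else 0
  | _ + 1, D, [none] => stepProb ε δ Δ kbar h D none
  | k + 1, D, some i :: rest =>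
      if i ∈ D then
        stepProb ε δ Δ kbar h D (some i) * prEMProb ε δ Δ kbar h k (D.erase i) rest
      else 0
  | _ + 1, _, _ => 0

theorem card_filter_kthLargest_le {d : ℕ} (h : Fin d → ℕ) {k : ℕ} (hk : 0 < k) (hkd : k ≤ d) :
    k ≤ (Finset.univ.filter fun i => kthLargest h k ≤ h i).card := by
  refine Nat.sSup_mem (s := {v | k ≤ (Finset.univ.filter fun i => v ≤ h i).card})
    ⟨0, by simpa using hkd⟩ ⟨Finset.univ.sup h, fun v hv => ?_⟩
  obtain ⟨i, hi⟩ := Finset.card_pos.mp (hk.trans_le hv)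
  exact (Finset.mem_filter.mp hi).2.trans (Finset.le_sup (Finset.mem_univ i))

theorem histRank_lt_of_precedes {d : ℕ} (h : Fin d → ℕ) {i j : Fin d}
    (hij : h i < h j ∨ (h j = h i ∧ j < i)) : histRank h j < histRank h i := by
  refine Finset.card_lt_card ((Finset.ssubset_iff_of_subset fun a ha => ?_).mpr ⟨j, ?_, ?_⟩)
  · simp only [Finset.mem_filter, Finset.mem_univ, true_and] at ha ⊢
    omega
  · simpa using hij
  · simp

theorem histRank_injective {d : ℕ} (h : Fin d → ℕ) : Function.Injective (histRank h) := by
  intro i j hij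
  by_contra hne
  have : (h i < h j ∨ (h j = h i ∧ j < i)) ∨ (h j < h i ∨ (h i = h j ∧ i < j)) := by
    omega
  rcases this with H | H
  · exact (histRank_lt_of_precedes h H).ne' hij
  · exact (histRank_lt_of_precedes h H).ne hij

theorem histRank_lt {d : ℕ} (h : Fin d → ℕ) (i : Fin d) : histRank h i < d := by
  have : histRank h i < (Finset.univ : Finset (Fin d)).card :=
    Finset.card_lt_card ((Finset.ssubset_iff_of_subset (Finset.subset_univ _)).mpr
      ⟨i, Finset.mem_univ i, by simp⟩)
  simpa using this

theorem card_limitedDomain {d : ℕ} (h : Fin d → ℕ) {k : ℕ} (hkd : k ≤ d) :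
    (limitedDomain h k).card = k := by
  have hinj : Function.Injective fun i => (⟨histRank h i, histRank_lt h i⟩ : Fin d) :=
    fun i j hij => histRank_injective h (Fin.mk.inj_iff.mp hij)
  have himage : (limitedDomain h k).image (histRank h) = Finset.range k := by
    ext r
    simp only [limitedDomain, Finset.mem_image, Finset.mem_filter, Finset.mem_univ, true_and,
      Finset.mem_range]
    constructor
    · rintro ⟨i, hi, rfl⟩
      exact hi
    · intro hr
      obtain ⟨i, hi⟩ := Finite.surjective_of_injective hinj ⟨r, hr.trans_le hkd⟩
      have hi' : histRank h i = r := Fin.mk.inj_iff.mp hi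
      exact ⟨i, hi' ▸ hr, hi'⟩
  rw [← Finset.card_image_of_injective _ (histRank_injective h), himage, Finset.card_range]

theorem limitedDomain_mono {d : ℕ} (h : Fin d → ℕ) : Monotone (limitedDomain h) := by
  intro k l hkl i hi
  simp only [limitedDomain, Finset.mem_filter, Finset.mem_univ, true_and] at hi ⊢
  omega

theorem kthLargest_le_of_mem_limitedDomain {d : ℕ} (h : Fin d → ℕ) {k : ℕ} (hkd : k ≤ d)
    {i : Fin d} (hi : i ∈ limitedDomain h k) : kthLargest h k ≤ h i := by
  have hrank : histRank h i < k := (Finset.mem_filter.mp hi).2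
  by_contra! hlt
  refine hrank.not_ge ((card_filter_kthLargest_le h (by omega) hkd).trans
    (Finset.card_le_card fun j hj => ?_))
  simp only [Finset.mem_filter, Finset.mem_univ, true_and] at hj ⊢
  omega

theorem emWeight_pos {d : ℕ} (ε δ : ℝ) (Δ kbar : ℕ) (h : Fin d → ℕ) (o : Option (Fin d)) :
    0 < emWeight ε δ Δ kbar h o := by
  cases o <;> exact Real.exp_pos _

theorem stepProb_none_add_sum {d : ℕ} (ε δ : ℝ) (Δ kbar : ℕ) (h : Fin d → ℕ)
    (D : Finset (Fin d)) :
    stepProb ε δ Δ kbar h D none + ∑ i ∈ D, stepProb ε δ Δ kbar h D (some i) = 1 := by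
  have hpos := add_pos_of_pos_of_nonneg (emWeight_pos ε δ Δ kbar h none)
    (Finset.sum_nonneg fun j (_ : j ∈ D) => (emWeight_pos ε δ Δ kbar h (some j)).le)
  simp only [stepProb]
  rw [← Finset.sum_div, ← add_div, div_self hpos.ne']

theorem stepProb_nonneg {d : ℕ} (ε δ : ℝ) (Δ kbar : ℕ) (h : Fin d → ℕ)
    (D : Finset (Fin d)) (o : Option (Fin d)) : 0 ≤ stepProb ε δ Δ kbar h D o :=
  div_nonneg (emWeight_pos ..).le (add_nonneg (emWeight_pos ..).le
    (Finset.sum_nonneg fun _ _ => (emWeight_pos ..).le))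

theorem stepProb_none_le {d : ℕ} {ε δ : ℝ} {Δ kbar : ℕ} {h : Fin d → ℕ}
    {D : Finset (Fin d)} {i : Fin d} (hi : i ∈ D) {r : ℝ} (hr : 0 ≤ r)
    (hw : emWeight ε δ Δ kbar h none ≤ r * emWeight ε δ Δ kbar h (some i)) :
    stepProb ε δ Δ kbar h D none ≤ r := by
  have hnone := emWeight_pos ε δ Δ kbar h none
  have hsum := Finset.single_le_sum
    (fun j (_ : j ∈ D) => (emWeight_pos ε δ Δ kbar h (some j)).le) hi
  have hsome := emWeight_pos ε δ Δ kbar h (some i)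
  rw [stepProb, div_le_iff₀ (by linarith)]
  exact hw.trans (mul_le_mul_of_nonneg_left (by linarith) hr)

/-- Splitting off the first entry of a list without `none`. -/
noncomputable def consSomeEquiv (α : Type*) (k : ℕ) :
    α × {l : List (Option α) // none ∉ l ∧ l.length = k} ≃
      {l : List (Option α) // none ∉ l ∧ l.length = k + 1} :=
  Equiv.ofBijective
    (fun p => ⟨some p.1 :: p.2.1, by simpa using p.2.2⟩) <| by
    constructor
    · rintro ⟨a, l, hl⟩ ⟨b, m, hm⟩ hab
      simpa using hab
    · rintro ⟨l, hl⟩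
      match l, hl with
      | [], hl => simp at hl
      | none :: l, hl => simp at hl
      | some a :: l, hl => exact ⟨(a, ⟨l, by simpa using hl⟩), rfl⟩

theorem coe_consSomeEquiv {α : Type*} {k : ℕ} (a : α)
    (l : {l : List (Option α) // none ∉ l ∧ l.length = k}) :
    (consSomeEquiv α k (a, l) : List (Option α)) = some a :: l.1 :=
  rfl

/-- The probability that the peeling mechanism outputs `k` indices. -/
noncomputable def prEMFullProb {d : ℕ} (ε δ : ℝ) (Δ kbar : ℕ) (h : Fin d → ℕ) (k : ℕ)
    (D : Finset (Fin d)) : ℝ :=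
  ∑' l : {l : List (Option (Fin d)) // none ∉ l ∧ l.length = k},
    prEMProb ε δ Δ kbar h k D (l : List (Option (Fin d)))

theorem prEMFullProb_zero {d : ℕ} (ε δ : ℝ) (Δ kbar : ℕ) (h : Fin d → ℕ)
    (D : Finset (Fin d)) : prEMFullProb ε δ Δ kbar h 0 D = 1 := by
  rw [prEMFullProb, tsum_eq_single ⟨[], by simp⟩]
  · simp [prEMProb]
  · rintro ⟨l, hl⟩ hne
    exact (hne (Subtype.ext (List.length_eq_zero_iff.mp hl.2))).elim

theorem prEMFullProb_succ {d : ℕ} (ε δ : ℝ) (Δ kbar : ℕ) (h : Fin d → ℕ) (k : ℕ)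
    (D : Finset (Fin d)) :
    prEMFullProb ε δ Δ kbar h (k + 1) D =
      ∑ i ∈ D, stepProb ε δ Δ kbar h D (some i) *
        prEMFullProb ε δ Δ kbar h k (D.erase i) := by
  have : Finite {l : List (Option (Fin d)) // none ∉ l ∧ l.length = k} :=
    ((List.finite_length_eq (Option (Fin d)) k).subset fun _ hl => hl.2).to_subtype
  have := Fintype.ofFinite {l : List (Option (Fin d)) // none ∉ l ∧ l.length = k}
  simp only [prEMFullProb]
  rw [← (consSomeEquiv (Fin d) k).tsum_eq, tsum_fintype, Fintype.sum_prod_type,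
    ← Finset.sum_subset (Finset.subset_univ D)]
  · refine Finset.sum_congr rfl fun i hi => ?_
    simp [coe_consSomeEquiv, prEMProb, hi, tsum_fintype, Finset.mul_sum]
  · intro i _ hi
    simp [coe_consSomeEquiv, prEMProb, hi]

theorem one_sub_mul_le_prEMFullProb {d : ℕ} {ε δ : ℝ} {Δ kbar : ℕ} {h : Fin d → ℕ}
    {r : ℝ} (hr : 0 ≤ r) (k : ℕ) (D G : Finset (Fin d)) (hGD : G ⊆ D) (hG : k ≤ G.card)
    (hw : ∀ i ∈ G, emWeight ε δ Δ kbar h none ≤ r * emWeight ε δ Δ kbar h (some i)) :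
    1 - k * r ≤ prEMFullProb ε δ Δ kbar h k D := by
  induction k generalizing D G with
  | zero => simp [prEMFullProb_zero]
  | succ k ih =>
    obtain ⟨i, hi⟩ := Finset.card_pos.mp (k.succ_pos.trans_le hG)
    have hnone := stepProb_none_le (hGD hi) hr (hw i hi)
    have htotal := stepProb_none_add_sum ε δ Δ kbar h D
    have hbound : (∑ i ∈ D, stepProb ε δ Δ kbar h D (some i)) * (1 - k * r) ≤
        prEMFullProb ε δ Δ kbar h (k + 1) D := by
      rw [prEMFullProb_succ, Finset.sum_mul]
      refine Finset.sum_le_sum fun j _ => mul_le_mul_of_nonneg_left ?_ (stepProb_nonneg ..)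
      refine ih (D.erase j) (G.erase j) (Finset.erase_subset_erase j hGD) ?_
        fun a ha => hw a (Finset.mem_of_mem_erase ha)
      have := Finset.pred_card_le_card_erase (s := G) (a := j)
      omega
    have hprod : 0 ≤ stepProb ε δ Δ kbar h D none * (k * r) :=
      mul_nonneg (stepProb_nonneg ..) (by positivity)
    rw [← eq_sub_iff_add_eq'] at htotal
    rw [htotal] at hbound
    push_cast
    linarith

/-- Lemma 21, second part: if the `k`-th largest count is sufficiently far above the
threshold, `h_{(k)} ≥ h_{(k̄+1)} + 1 + ln(min{Δ,k̄}/δ)/ε + ln(k/β)/ε`, then with probability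
at least `1 − β` the mechanism `prEM_{k,k̄}(h, D_{k̄}(h))` outputs exactly `k` indices
(its output does not contain `⊥`). -/
theorem stmt_18 (d : ℕ) (ε δ : ℝ) (hε : 0 < ε) (hδ : 0 < δ) (β : ℝ) (hβ : β ∈ Set.Ioo (0:ℝ) 1)
    (Δ : ℕ) (hΔ : 1 ≤ Δ) (k kbar : ℕ) (hkk : k ≤ kbar) (hkd : kbar < d)
    (h : Fin d → ℕ)
    (hgap : (kthLargest h k : ℝ) ≥ (kthLargest h (kbar + 1) : ℝ) + 1 +
        Real.log ((min Δ kbar : ℕ) / δ) / ε + Real.log ((k : ℝ) / β) / ε) :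
    1 - β ≤ ∑' l : {l : List (Option (Fin d)) // none ∉ l ∧ l.length = k},
        prEMProb ε δ Δ kbar h k (limitedDomain h kbar) (l : List (Option (Fin d))) := by
  rcases Nat.eq_zero_or_pos k with rfl | hk
  · exact (sub_le_self 1 hβ.1.le).trans (prEMFullProb_zero ε δ Δ kbar h _).ge
  have hk' : (0 : ℝ) < k := Nat.cast_pos.mpr hk
  have hkd' : k ≤ d := hkk.trans hkd.le
  have hmain := one_sub_mul_le_prEMFullProb (ε := ε) (δ := δ) (Δ := Δ) (kbar := kbar) (h := h)
    (div_nonneg hβ.1.le hk'.le) k _ _ (limitedDomain_mono h hkk)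
    (card_limitedDomain h hkd').ge fun i hi => ?_
  · rwa [mul_div_cancel₀ _ hk'.ne'] at hmain
  · have hcount : (kthLargest h k : ℝ) ≤ h i :=
      Nat.cast_le.mpr (kthLargest_le_of_mem_limitedDomain h hkd' hi)
    have hgap' : hBot ε δ Δ kbar h + Real.log (k / β) / ε ≤ h i := by
      rw [hBot]
      linarith
    have hscaled := mul_le_mul_of_nonneg_left hgap' hε.le
    rw [mul_add, mul_div_cancel₀ _ hε.ne'] at hscaled
    have hlog : Real.log (β / k) = -Real.log (k / β) := by rw [← Real.log_inv, inv_div]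
    simp only [emWeight]
    rw [← Real.exp_log (div_pos hβ.1 hk'), ← Real.exp_add, hlog]
    exact Real.exp_le_exp.mpr (by linarith)
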